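/- Let 𝓗 be an infinite-dimensional complex Hilbert space. Define a partial operation ⊕̄ on 𝓥_f(𝓗) by: t ⊕̄ s is defined iff t ⊕ s is defined and (t+s)_r = t_r + s_r, and then t ⊕̄ s = t ⊕ s. Then (𝓥_f(𝓗); ⊕̄, o) is a generalized effect algebra. -/

import Mathlib

set_option autoImplicit false

noncomputable section

open Filter

variable {H : Type*}

/-- A densely defined positive bilinear (sesquilinear) form on a complex Hilbert space `H`:
it is given by a dense domain `dom` and a map `toFun : H → H → ℂ` which is linear in the
first argument and conjugate-linear in the second one on the domain, takes real nonnegative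
values on the diagonal of the domain, and (as a normalization) vanishes off the domain. -/
structure PBF (H : Type*) [NormedAddCommGroup H] [InnerProductSpace ℂ H] where
  dom : Submodule ℂ H
  dense' : Dense (dom : Set H)
  toFun : H → H → ℂ
  zero_off : ∀ x y : H, x ∉ dom ∨ y ∉ dom → toFun x y = 0
  add_left : ∀ x y z : H, x ∈ dom → y ∈ dom → z ∈ dom →
    toFun (x + y) z = toFun x z + toFun y z
  smul_left : ∀ (c : ℂ) (x y : H), x ∈ dom → y ∈ dom →
    toFun (c • x) y = c * toFun x y
  add_right : ∀ x y z : H, x ∈ dom → y ∈ dom → z ∈ dom →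
    toFun x (y + z) = toFun x y + toFun x z
  smul_right : ∀ (c : ℂ) (x y : H), x ∈ dom → y ∈ dom →
    toFun x (c • y) = (starRingEnd ℂ) c * toFun x y
  re_nonneg : ∀ x : H, x ∈ dom → 0 ≤ (toFun x x).re
  im_zero : ∀ x : H, x ∈ dom → (toFun x x).im = 0

variable [NormedAddCommGroup H] [InnerProductSpace ℂ H]

namespace PBF

/-- A positive bilinear form is bounded if `sup {t(x,x) : x ∈ D(t), ‖x‖ = 1} < ∞`. -/
def Bounded (t : PBF H) : Prop :=
  ∃ c : ℝ, ∀ x ∈ t.dom, (t.toFun x x).re ≤ c * ‖x‖ ^ 2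

/-- Membership in `𝓥_f(𝓗)`: a positive bilinear form whose domain is all of `H`
whenever the form is bounded. -/
def InVf (t : PBF H) : Prop := t.Bounded → t.dom = ⊤

/-- `u` is the usual sum `t + s`, with domain `D(t) ⊓ D(s)`. -/
def IsSum (t s u : PBF H) : Prop :=
  u.dom = t.dom ⊓ s.dom ∧
  ∀ x y : H, x ∈ u.dom → y ∈ u.dom → u.toFun x y = t.toFun x y + s.toFun x y

/-- Definedness of the partial operation `⊕` on `𝓥_f(𝓗)`:
`t ⊕ s` is defined iff `t` or `s` is bounded, or `D(t) = D(s)`. -/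
def OplusDef (t s : PBF H) : Prop := t.Bounded ∨ s.Bounded ∨ t.dom = s.dom

/-- `t ⊕ s = u` in `𝓥_f(𝓗)`. -/
def Oplus (t s u : PBF H) : Prop := OplusDef t s ∧ IsSum t s u

/-- The squared norm `‖x‖_t² = t(x,x) + ‖x‖²` associated with the inner product
`(x,y)_t := t(x,y) + (x,y)` on `D(t)`. -/
def q (t : PBF H) (x : H) : ℝ := (t.toFun x x).re + ‖x‖ ^ 2

/-- `t` is closed: `D(t)` is complete under the inner product `(x,y)_t := t(x,y) + (x,y)`
(sequential formulation of completeness). -/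
def IsClosedForm (t : PBF H) : Prop :=
  ∀ f : ℕ → H, (∀ n, f n ∈ t.dom) →
    (∀ ε : ℝ, 0 < ε → ∃ N : ℕ, ∀ m ≥ N, ∀ n ≥ N, t.q (f m - f n) < ε) →
    ∃ x ∈ t.dom, Tendsto (fun n => t.q (f n - x)) atTop (nhds 0)

/-- `s` is an extension of `t` (i.e. `s|_{D(t)} = t`). -/
def Extends (s t : PBF H) : Prop :=
  t.dom ≤ s.dom ∧ ∀ x y : H, x ∈ t.dom → y ∈ t.dom → s.toFun x y = t.toFun x y

/-- `t` is closable (equivalently, regular) iff it has a closed extension. -/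
def Closable (t : PBF H) : Prop := ∃ s : PBF H, s.IsClosedForm ∧ s.Extends t

/-- `t` is singular: the only closable positive bilinear form `r` with `D(r) = D(t)` and
`r(x,x) ≤ t(x,x)` on `D(t)` is the zero form. -/
def Singular (t : PBF H) : Prop :=
  ∀ r : PBF H, r.Closable → r.dom = t.dom →
    (∀ x ∈ t.dom, (r.toFun x x).re ≤ (t.toFun x x).re) →
    ∀ x y : H, r.toFun x y = 0

/-- `tr` is the regular part of `t`: the largest closable positive bilinear form `r` with
`D(r) = D(t)` and `r(x,x) ≤ t(x,x)` for all `x ∈ D(t)` (Simon's decomposition theorem). -/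
def IsRegularPart (t tr : PBF H) : Prop :=
  tr.Closable ∧ tr.dom = t.dom ∧
  (∀ x ∈ t.dom, (tr.toFun x x).re ≤ (t.toFun x x).re) ∧
  ∀ r : PBF H, r.Closable → r.dom = t.dom →
    (∀ x ∈ t.dom, (r.toFun x x).re ≤ (t.toFun x x).re) →
    ∀ x ∈ t.dom, (r.toFun x x).re ≤ (tr.toFun x x).re

end PBF

/-- The zero form `o`, with `D(o) = 𝓗`. -/
def zeroPBF (H : Type*) [NormedAddCommGroup H] [InnerProductSpace ℂ H] : PBF H where
  dom := ⊤
  dense' := by rw [Submodule.top_coe]; exact dense_univ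
  toFun := fun _ _ => 0
  zero_off := fun _ _ _ => rfl
  add_left := by intros; simp
  smul_left := by intros; simp
  add_right := by intros; simp
  smul_right := by intros; simp
  re_nonneg := by intros; simp
  im_zero := by intros; simp

/-- `Q` is (the carrier of) a sub-generalized effect algebra of `(𝓥_f(𝓗); ⊕, o)`:
it contains `o`, and whenever `x ⊕ y = z` in `𝓥_f(𝓗)` with at least two of `x, y, z`
in `Q`, then all three are in `Q`. -/
def SubGEACond (Q : PBF H → Prop) : Prop :=
  Q (zeroPBF H) ∧
  ∀ x y z : PBF H, x.InVf → y.InVf → z.InVf → PBF.Oplus x y z →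
    ((Q x ∧ Q y) ∨ (Q x ∧ Q z) ∨ (Q y ∧ Q z)) → (Q x ∧ Q y ∧ Q z)

/-- Membership in the generalized effect algebra carried by `{t ∈ 𝓥_f(𝓗) : Q t}`. -/
def MemAlg (Q : PBF H → Prop) (t : PBF H) : Prop := t.InVf ∧ Q t

/-- The order induced by the restricted operation `⊕|_Q` on `{t ∈ 𝓥_f(𝓗) : Q t}`:
`s ≤ t` iff `s ⊕ r = t` for some `r` in the algebra. -/
def leQ (Q : PBF H → Prop) (s t : PBF H) : Prop :=
  ∃ r : PBF H, MemAlg Q r ∧ PBF.Oplus s r t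

/-- The order induced by `⊕` on `𝓥_f(𝓗)`: `s ≤ t` iff `s ⊕ r = t` for some `r ∈ 𝓥_f(𝓗)`. -/
def leVf (s t : PBF H) : Prop := ∃ r : PBF H, r.InVf ∧ PBF.Oplus s r t

/-- The algebra `{t ∈ 𝓥_f(𝓗) : Q t}` is monotone Dedekind upwards σ-complete: every
non-decreasing sequence dominated by some element has a supremum (w.r.t. the induced order). -/
def UpSigmaQ (Q : PBF H → Prop) : Prop :=
  ∀ f : ℕ → PBF H, (∀ n, MemAlg Q (f n)) → (∀ n, leQ Q (f n) (f (n + 1))) →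
    (∃ b : PBF H, MemAlg Q b ∧ ∀ n, leQ Q (f n) b) →
    ∃ s : PBF H, MemAlg Q s ∧ (∀ n, leQ Q (f n) s) ∧
      ∀ z : PBF H, MemAlg Q z → (∀ n, leQ Q (f n) z) → leQ Q s z

/-- The algebra `{t ∈ 𝓥_f(𝓗) : Q t}` is monotone Dedekind downwards σ-complete: every
non-increasing sequence has an infimum (w.r.t. the induced order). -/
def DownSigmaQ (Q : PBF H → Prop) : Prop :=
  ∀ f : ℕ → PBF H, (∀ n, MemAlg Q (f n)) → (∀ n, leQ Q (f (n + 1)) (f n)) →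
    ∃ i : PBF H, MemAlg Q i ∧ (∀ n, leQ Q i (f n)) ∧
      ∀ z : PBF H, MemAlg Q z → (∀ n, leQ Q z (f n)) → leQ Q z i

/-- Definedness of the restricted operation `⊕̄` on `𝓥_f(𝓗)`: `t ⊕̄ s` is defined iff
`t ⊕ s` is defined and `(t+s)_r = t_r + s_r` (the regular parts add up). -/
def ObarDef (t s : PBF H) : Prop :=
  PBF.OplusDef t s ∧
  ∀ u tr sr ur : PBF H, PBF.IsSum t s u →
    t.IsRegularPart tr → s.IsRegularPart sr → u.IsRegularPart ur →
    PBF.IsSum tr sr ur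

/-- `t ⊕̄ s = u`. -/
def Obar (t s u : PBF H) : Prop := ObarDef t s ∧ PBF.IsSum t s u

/-- The order induced by `⊕̄` on `𝓥_f(𝓗)`. -/
def leBar (s t : PBF H) : Prop := ∃ r : PBF H, r.InVf ∧ Obar s r t

namespace PBF

/-- Expansion of the quadratic form along `x + c • y`. -/
theorem toFun_add_smul_self (t : PBF H) (c : ℂ) {x y : H} (hx : x ∈ t.dom) (hy : y ∈ t.dom) :
    t.toFun (x + c • y) (x + c • y) =
      t.toFun x x + (starRingEnd ℂ) c * t.toFun x y + c * t.toFun y x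
        + c * (starRingEnd ℂ) c * t.toFun y y := by
  have hcy := t.dom.smul_mem c hy
  rw [t.add_left _ _ _ hx hcy (t.dom.add_mem hx hcy), t.add_right _ _ _ hx hx hcy,
    t.add_right _ _ _ hcy hx hcy, t.smul_right c _ _ hx hy, t.smul_left c _ _ hy hx,
    t.smul_left c _ _ hy hcy, t.smul_right c _ _ hy hy]
  ring

theorem toFun_self_eq_ofReal (t : PBF H) {x : H} (hx : x ∈ t.dom) :
    t.toFun x x = ((t.toFun x x).re : ℂ) :=
  Complex.ext (by simp) (by simp [t.im_zero x hx])

/-- Polarization: the form is determined by its quadratic form. -/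
theorem toFun_eq_polarization (t : PBF H) {x y : H} (hx : x ∈ t.dom) (hy : y ∈ t.dom) :
    t.toFun x y =
      ((((t.toFun (x + (1 : ℂ) • y) (x + (1 : ℂ) • y)).re
          - (t.toFun x x).re - (t.toFun y y).re : ℝ) : ℂ)
        + Complex.I * (((t.toFun (x + Complex.I • y) (x + Complex.I • y)).re
          - (t.toFun x x).re - (t.toFun y y).re : ℝ) : ℂ)) / 2 := by
  have e1 := t.toFun_add_smul_self 1 hx hy
  have e2 := t.toFun_add_smul_self Complex.I hx hy
  push_cast
  rw [← t.toFun_self_eq_ofReal hx, ← t.toFun_self_eq_ofReal hy,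
    ← t.toFun_self_eq_ofReal (t.dom.add_mem hx (t.dom.smul_mem _ hy)),
    ← t.toFun_self_eq_ofReal (t.dom.add_mem hx (t.dom.smul_mem _ hy)), e1, e2]
  simp only [map_one, Complex.conj_I]
  linear_combination (t.toFun x y / 2 - t.toFun y x / 2 + Complex.I / 2 * t.toFun y y)
    * Complex.I_sq

theorem conj_toFun (t : PBF H) {x y : H} (hx : x ∈ t.dom) (hy : y ∈ t.dom) :
    (starRingEnd ℂ) (t.toFun x y) = t.toFun y x := by
  have e1 := t.toFun_add_smul_self 1 hx hy
  have e2 := t.toFun_add_smul_self Complex.I hx hy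
  have i1 := t.im_zero _ (t.dom.add_mem hx (t.dom.smul_mem (1 : ℂ) hy))
  have i2 := t.im_zero _ (t.dom.add_mem hx (t.dom.smul_mem Complex.I hy))
  have ix := t.im_zero x hx
  have iy := t.im_zero y hy
  rw [e1] at i1
  rw [e2] at i2
  simp at i1 i2
  apply Complex.ext
  · simp; linarith
  · simp; linarith

theorem ext_toFun {t s : PBF H} (hd : t.dom = s.dom)
    (h : ∀ x y : H, x ∈ t.dom → y ∈ t.dom → t.toFun x y = s.toFun x y) : t = s := by
  have hf : t.toFun = s.toFun := by
    funext x y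
    by_cases hxy : x ∈ t.dom ∧ y ∈ t.dom
    · exact h x y hxy.1 hxy.2
    · rw [not_and_or] at hxy
      rw [t.zero_off x y hxy, s.zero_off x y (hd ▸ hxy)]
  cases t
  cases s
  simp only at hd hf
  subst hd hf
  rfl

theorem toFun_eq_of_re_eq {t s : PBF H} {D : Submodule ℂ H} (ht : D ≤ t.dom) (hs : D ≤ s.dom)
    (h : ∀ x ∈ D, (t.toFun x x).re = (s.toFun x x).re) {x y : H} (hx : x ∈ D) (hy : y ∈ D) :
    t.toFun x y = s.toFun x y := by
  rw [t.toFun_eq_polarization (ht hx) (ht hy), s.toFun_eq_polarization (hs hx) (hs hy),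
    h x hx, h y hy, h _ (D.add_mem hx (D.smul_mem _ hy)), h _ (D.add_mem hx (D.smul_mem _ hy))]

theorem ext_re {t s : PBF H} (hd : t.dom = s.dom)
    (h : ∀ x ∈ t.dom, (t.toFun x x).re = (s.toFun x x).re) : t = s :=
  ext_toFun hd fun _ _ => toFun_eq_of_re_eq le_rfl hd.le h

open Classical in
/-- The form on `D` given by a function which is sesquilinear and positive on `D`. -/
def ofFun (D : Submodule ℂ H) (hD : Dense (D : Set H)) (f : H → H → ℂ)
    (add_left : ∀ x y z : H, x ∈ D → y ∈ D → z ∈ D → f (x + y) z = f x z + f y z)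
    (smul_left : ∀ (c : ℂ) (x y : H), x ∈ D → y ∈ D → f (c • x) y = c * f x y)
    (add_right : ∀ x y z : H, x ∈ D → y ∈ D → z ∈ D → f x (y + z) = f x y + f x z)
    (smul_right : ∀ (c : ℂ) (x y : H), x ∈ D → y ∈ D → f x (c • y) = (starRingEnd ℂ) c * f x y)
    (re_nonneg : ∀ x : H, x ∈ D → 0 ≤ (f x x).re)
    (im_zero : ∀ x : H, x ∈ D → (f x x).im = 0) : PBF H where
  dom := D
  dense' := hD
  toFun x y := if x ∈ D ∧ y ∈ D then f x y else 0
  zero_off x y h := if_neg (by tauto)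
  add_left x y z hx hy hz := by
    simp only [hx, hy, hz, D.add_mem hx hy, and_self, if_true, add_left]
  smul_left c x y hx hy := by
    simp only [hx, hy, D.smul_mem c hx, and_self, if_true, smul_left]
  add_right x y z hx hy hz := by
    simp only [hx, hy, hz, D.add_mem hy hz, and_self, if_true, add_right]
  smul_right c x y hx hy := by
    simp only [hx, hy, D.smul_mem c hy, and_self, if_true, smul_right]
  re_nonneg x hx := by simpa only [hx, and_self, if_true] using re_nonneg x hx
  im_zero x hx := by simpa only [hx, and_self, if_true] using im_zero x hx

/-- The restriction of a form to a dense subspace of its domain. -/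
def restrict (t : PBF H) (D : Submodule ℂ H) (hD : Dense (D : Set H)) (h : D ≤ t.dom) : PBF H :=
  ofFun D hD t.toFun
    (fun _ _ _ hx hy hz => t.add_left _ _ _ (h hx) (h hy) (h hz))
    (fun _ _ _ hx hy => t.smul_left _ _ _ (h hx) (h hy))
    (fun _ _ _ hx hy hz => t.add_right _ _ _ (h hx) (h hy) (h hz))
    (fun _ _ _ hx hy => t.smul_right _ _ _ (h hx) (h hy))
    (fun _ hx => t.re_nonneg _ (h hx)) (fun _ hx => t.im_zero _ (h hx))

theorem restrict_toFun (t : PBF H) (D : Submodule ℂ H) (hD : Dense (D : Set H)) (h : D ≤ t.dom)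
    {x y : H} (hx : x ∈ D) (hy : y ∈ D) : (t.restrict D hD h).toFun x y = t.toFun x y :=
  if_pos ⟨hx, hy⟩

/-- The sum of two forms whose domains have a dense intersection. -/
def add (t s : PBF H) (h : Dense ((t.dom ⊓ s.dom : Submodule ℂ H) : Set H)) : PBF H :=
  ofFun (t.dom ⊓ s.dom) h (fun x y => t.toFun x y + s.toFun x y)
    (fun x y z hx hy hz => by
      rw [t.add_left x y z hx.1 hy.1 hz.1, s.add_left x y z hx.2 hy.2 hz.2]; ring)
    (fun c x y hx hy => by
      rw [t.smul_left c x y hx.1 hy.1, s.smul_left c x y hx.2 hy.2]; ring)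
    (fun x y z hx hy hz => by
      rw [t.add_right x y z hx.1 hy.1 hz.1, s.add_right x y z hx.2 hy.2 hz.2]; ring)
    (fun c x y hx hy => by
      rw [t.smul_right c x y hx.1 hy.1, s.smul_right c x y hx.2 hy.2]; ring)
    (fun x hx => add_nonneg (t.re_nonneg x hx.1) (s.re_nonneg x hx.2))
    (fun x hx => by simp [t.im_zero x hx.1, s.im_zero x hx.2])

theorem isSum_add (t s : PBF H) (h : Dense ((t.dom ⊓ s.dom : Submodule ℂ H) : Set H)) :
    IsSum t s (t.add s h) :=
  ⟨rfl, fun _ _ hx hy => if_pos ⟨hx, hy⟩⟩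

theorem IsSum.symm {t s u : PBF H} (h : IsSum t s u) : IsSum s t u :=
  ⟨h.1.trans (inf_comm _ _), fun x y hx hy => (h.2 x y hx hy).trans (add_comm _ _)⟩

theorem IsSum.unique {t s u v : PBF H} (hu : IsSum t s u) (hv : IsSum t s v) : u = v := by
  have hd : u.dom = v.dom := hu.1.trans hv.1.symm
  exact ext_toFun hd fun x y hx hy => by rw [hu.2 x y hx hy, hv.2 x y (hd ▸ hx) (hd ▸ hy)]

theorem IsSum.re {t s u : PBF H} (h : IsSum t s u) {x : H} (hx : x ∈ u.dom) :
    (u.toFun x x).re = (t.toFun x x).re + (s.toFun x x).re := by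
  rw [h.2 x x hx hx, Complex.add_re]

theorem IsSum.mem {t s u : PBF H} (h : IsSum t s u) {x : H} (hx : x ∈ u.dom) :
    x ∈ t.dom ∧ x ∈ s.dom := by
  rwa [h.1] at hx

theorem IsSum.dense {t s u : PBF H} (h : IsSum t s u) :
    Dense ((t.dom ⊓ s.dom : Submodule ℂ H) : Set H) :=
  h.1 ▸ u.dense'

theorem isSum_of_re {t s u : PBF H} (hd : u.dom = t.dom ⊓ s.dom)
    (h : ∀ x ∈ u.dom, (u.toFun x x).re = (t.toFun x x).re + (s.toFun x x).re) :
    IsSum t s u := by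
  have hs := isSum_add t s (hd ▸ u.dense')
  rw [show u = t.add s (hd ▸ u.dense') from
    ext_re hd fun x hx => by rw [h x hx, hs.re (hd.le hx)]]
  exact hs

theorem oplusDef_dense {t s : PBF H} (ht : t.InVf) (hs : s.InVf) (h : OplusDef t s) :
    Dense ((t.dom ⊓ s.dom : Submodule ℂ H) : Set H) := by
  rcases h with h | h | h
  · rw [ht h, top_inf_eq]; exact s.dense'
  · rw [hs h, inf_top_eq]; exact t.dense'
  · rw [h, inf_idem]; exact s.dense'

theorem OplusDef.symm {t s : PBF H} (h : OplusDef t s) : OplusDef s t := by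
  rcases h with h | h | h
  exacts [.inr (.inl h), .inl h, .inr (.inr h.symm)]

theorem IsSum.bounded {t s u : PBF H} (h : IsSum t s u) (ht : t.Bounded) (hs : s.Bounded) :
    u.Bounded := by
  obtain ⟨a, ha⟩ := ht
  obtain ⟨b, hb⟩ := hs
  refine ⟨a + b, fun x hx => ?_⟩
  rw [h.re hx]
  linarith [ha x (h.mem hx).1, hb x (h.mem hx).2]

theorem IsSum.bounded_left {t s u : PBF H} (h : IsSum t s u) (hu : u.Bounded)
    (hts : t.dom ≤ s.dom) : t.Bounded := by
  obtain ⟨c, hc⟩ := hu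
  refine ⟨c, fun x hx => ?_⟩
  have hxu : x ∈ u.dom := by rw [h.1]; exact ⟨hx, hts hx⟩
  linarith [hc x hxu, h.re hxu, s.re_nonneg x (hts hx)]

/-- If the sum is bounded, then both summands are everywhere defined. -/
theorem IsSum.dom_eq_top {t s u : PBF H} (ht : t.InVf) (hs : s.InVf) (hd : OplusDef t s)
    (h : IsSum t s u) (hu : u.Bounded) : t.dom = ⊤ ∧ s.dom = ⊤ := by
  rcases hd with hb | hb | hb
  · have htop := ht hb
    exact ⟨htop, hs (h.symm.bounded_left hu (htop ▸ le_top))⟩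
  · have htop := hs hb
    exact ⟨ht (h.bounded_left hu (htop ▸ le_top)), htop⟩
  · exact ⟨ht (h.bounded_left hu hb.le), hs (h.symm.bounded_left hu hb.ge)⟩

theorem IsSum.inVf {t s u : PBF H} (ht : t.InVf) (hs : s.InVf) (hd : OplusDef t s)
    (h : IsSum t s u) : u.InVf := fun hu => by
  obtain ⟨h1, h2⟩ := h.dom_eq_top ht hs hd hu
  rw [h.1, h1, h2, inf_idem]

/-! ### The pre-Hilbert space of a form -/

/-- The domain of `t`, to be equipped with the inner product `t(x,y) + (x,y)`. -/
def FormSpace (t : PBF H) : Type _ := t.dom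

instance (t : PBF H) : AddCommGroup (FormSpace t) := inferInstanceAs (AddCommGroup t.dom)

instance (t : PBF H) : Module ℂ (FormSpace t) := inferInstanceAs (Module ℂ t.dom)

/-- The inclusion of the form space into `H`. -/
def incl (t : PBF H) : FormSpace t →ₗ[ℂ] H := t.dom.subtype

theorem incl_mem (t : PBF H) (x : FormSpace t) : t.incl x ∈ t.dom := Subtype.property x

theorem incl_injective (t : PBF H) : Function.Injective t.incl := Subtype.val_injective

/-- The inner product of the form space, linear in the second argument. -/
@[reducible] def formCore (t : PBF H) : InnerProductSpace.Core ℂ (FormSpace t) where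
  inner x y := t.toFun (t.incl y) (t.incl x) + inner ℂ (t.incl x) (t.incl y)
  conj_inner_symm x y := by
    rw [map_add, t.conj_toFun (t.incl_mem x) (t.incl_mem y), inner_conj_symm]
  re_inner_nonneg x := by
    rw [map_add]
    exact add_nonneg (t.re_nonneg _ (t.incl_mem x)) inner_self_nonneg
  add_left x y z := by
    rw [map_add, t.add_right _ _ _ (t.incl_mem z) (t.incl_mem x) (t.incl_mem y), inner_add_left]
    ring
  smul_left x y r := by
    rw [map_smul, t.smul_right r _ _ (t.incl_mem y) (t.incl_mem x), inner_smul_left]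
    ring
  definite x hx := by
    have h := congrArg Complex.re hx
    rw [Complex.add_re, Complex.zero_re] at h
    have h1 := t.re_nonneg _ (t.incl_mem x)
    have h2 : (inner ℂ (t.incl x) (t.incl x)).re = ‖t.incl x‖ ^ 2 :=
      (norm_sq_eq_re_inner (𝕜 := ℂ) _).symm
    have h3 : ‖t.incl x‖ ^ 2 = 0 := le_antisymm (by linarith) (sq_nonneg _)
    apply t.incl_injective
    rw [map_zero]
    exact norm_eq_zero.1 (pow_eq_zero_iff two_ne_zero |>.1 h3)

instance (t : PBF H) : NormedAddCommGroup (FormSpace t) := (formCore t).toNormedAddCommGroup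

instance (t : PBF H) : InnerProductSpace ℂ (FormSpace t) :=
  InnerProductSpace.ofCore (formCore t).toCore

theorem norm_sq_formSpace (t : PBF H) (x : FormSpace t) : ‖x‖ ^ 2 = t.q (t.incl x) := by
  rw [norm_sq_eq_re_inner (𝕜 := ℂ) x, q, norm_sq_eq_re_inner (𝕜 := ℂ) (t.incl x)]
  exact map_add _ _ _

theorem norm_sq_le_q (t : PBF H) {x : H} (hx : x ∈ t.dom) : ‖x‖ ^ 2 ≤ t.q x :=
  le_add_of_nonneg_left (t.re_nonneg x hx)

theorem tendsto_of_q_tendsto (t : PBF H) {f : ℕ → H} {x : H} (hf : ∀ n, f n ∈ t.dom)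
    (hx : x ∈ t.dom) (h : Tendsto (fun n => t.q (f n - x)) atTop (nhds 0)) :
    Tendsto f atTop (nhds x) := by
  rw [tendsto_iff_norm_sub_tendsto_zero]
  have hsq : Tendsto (fun n => √(t.q (f n - x))) atTop (nhds 0) := by simpa using h.sqrt
  exact squeeze_zero (fun _ => norm_nonneg _)
    (fun n => Real.le_sqrt_of_sq_le (t.norm_sq_le_q (t.dom.sub_mem (hf n) hx))) hsq

theorem tendsto_q (t : PBF H) {f : ℕ → H} {x : H} (hf : ∀ n, f n ∈ t.dom)
    (hx : x ∈ t.dom) (h : Tendsto (fun n => t.q (f n - x)) atTop (nhds 0)) :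
    Tendsto (fun n => t.q (f n)) atTop (nhds (t.q x)) := by
  let X : FormSpace t := ⟨x, hx⟩
  let Y : ℕ → FormSpace t := fun n => ⟨f n, hf n⟩
  have hYX : Tendsto Y atTop (nhds X) := by
    rw [tendsto_iff_norm_sub_tendsto_zero]
    have hn : ∀ n, ‖Y n - X‖ = √(t.q (f n - x)) := fun n => by
      rw [← Real.sqrt_sq (norm_nonneg (Y n - X)), norm_sq_formSpace]
      rfl
    simp only [hn]
    simpa using h.sqrt
  have h2 := hYX.norm.pow 2
  simp only [norm_sq_formSpace] at h2
  exact h2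

/-- The inclusion of the form space into `H`, as a contraction. -/
def inclL (t : PBF H) : FormSpace t →L[ℂ] H :=
  t.incl.mkContinuous 1 fun x => by
    rw [one_mul]
    exact le_of_sq_le_sq ((t.norm_sq_le_q (t.incl_mem x)).trans (t.norm_sq_formSpace x).ge)
      (norm_nonneg _)

end PBF

namespace PBF

/-! ### Forms from contractions -/

/-- The form `(j a, j b) ↦ (a, b) - (j a, j b)` on the range of an injective contraction `j`. -/
def ofContraction {K : Type*} [NormedAddCommGroup K] [InnerProductSpace ℂ K] (j : K →L[ℂ] H)
    (hj : Function.Injective j) (hle : ∀ a, ‖j a‖ ≤ ‖a‖) (hd : DenseRange j) : PBF H :=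
  ofFun (LinearMap.range (j : K →ₗ[ℂ] H)) (by rw [LinearMap.coe_range]; exact hd)
    (fun x y => inner ℂ (Function.invFun j y) (Function.invFun j x) - inner ℂ y x)
    (by
      rintro _ _ z ⟨a, rfl⟩ ⟨b, rfl⟩ -
      simp only [ContinuousLinearMap.coe_coe, ← map_add, Function.leftInverse_invFun hj _]
      simp only [map_add, inner_add_right]; ring)
    (by
      rintro c _ y ⟨a, rfl⟩ -
      simp only [ContinuousLinearMap.coe_coe, ← map_smul, Function.leftInverse_invFun hj _]
      simp only [map_smul, inner_smul_right]; ring)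
    (by
      rintro x _ _ - ⟨a, rfl⟩ ⟨b, rfl⟩
      simp only [ContinuousLinearMap.coe_coe, ← map_add, Function.leftInverse_invFun hj _]
      simp only [map_add, inner_add_left]; ring)
    (by
      rintro c x _ - ⟨a, rfl⟩
      simp only [ContinuousLinearMap.coe_coe, ← map_smul, Function.leftInverse_invFun hj _]
      simp only [map_smul, inner_smul_left]; ring)
    (by
      rintro _ ⟨a, rfl⟩
      simp only [ContinuousLinearMap.coe_coe, Function.leftInverse_invFun hj _]
      have h1 : (inner ℂ a a).re = ‖a‖ ^ 2 := (norm_sq_eq_re_inner (𝕜 := ℂ) a).symm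
      have h2 : (inner ℂ (j a) (j a)).re = ‖j a‖ ^ 2 := (norm_sq_eq_re_inner (𝕜 := ℂ) (j a)).symm
      rw [Complex.sub_re, h1, h2, sub_nonneg]
      exact pow_le_pow_left₀ (norm_nonneg _) (hle a) 2)
    (by
      intro x _
      have h1 : (inner ℂ (Function.invFun j x) (Function.invFun j x)).im = 0 :=
        inner_self_im (𝕜 := ℂ) _
      have h2 : (inner ℂ x x).im = 0 := inner_self_im (𝕜 := ℂ) x
      rw [Complex.sub_im, h1, h2, sub_zero])

section ofContraction

variable {K : Type*} [NormedAddCommGroup K] [InnerProductSpace ℂ K] (j : K →L[ℂ] H)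
  (hj : Function.Injective j) (hle : ∀ a, ‖j a‖ ≤ ‖a‖) (hd : DenseRange j)

theorem q_ofContraction (a : K) : (ofContraction j hj hle hd).q (j a) = ‖a‖ ^ 2 := by
  have h : (ofContraction j hj hle hd).toFun (j a) (j a) = inner ℂ a a - inner ℂ (j a) (j a) := by
    refine (if_pos ⟨⟨a, rfl⟩, ⟨a, rfl⟩⟩).trans ?_
    rw [Function.leftInverse_invFun hj a]
  have h1 : (inner ℂ a a).re = ‖a‖ ^ 2 := (norm_sq_eq_re_inner (𝕜 := ℂ) a).symm
  have h2 : (inner ℂ (j a) (j a)).re = ‖j a‖ ^ 2 := (norm_sq_eq_re_inner (𝕜 := ℂ) (j a)).symm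
  rw [q, h, Complex.sub_re, h1, h2, sub_add_cancel]

theorem isClosedForm_ofContraction [CompleteSpace K] :
    (ofContraction j hj hle hd).IsClosedForm := by
  intro f hf hc
  choose a ha using hf
  simp only [ContinuousLinearMap.coe_coe] at ha
  have hcs : CauchySeq a := by
    refine Metric.cauchySeq_iff.2 fun ε hε => ?_
    obtain ⟨N, hN⟩ := hc (ε ^ 2) (by positivity)
    refine ⟨N, fun m hm n hn => ?_⟩
    have h := hN m hm n hn
    rw [← ha, ← ha, ← map_sub, q_ofContraction] at h
    rw [dist_eq_norm]
    exact lt_of_pow_lt_pow_left₀ 2 hε.le h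
  obtain ⟨b, hb⟩ := cauchySeq_tendsto_of_complete hcs
  refine ⟨j b, ⟨b, rfl⟩, ?_⟩
  simp only [← ha, ← map_sub, q_ofContraction]
  simpa using (tendsto_iff_norm_sub_tendsto_zero.1 hb).pow 2

end ofContraction

/-! ### Simon's decomposition theorem -/

section Simon

variable [CompleteSpace H] (t : PBF H)

open UniformSpace

/-- The extension of the inclusion of the form space to its completion. -/
def completionL : Completion (FormSpace t) →L[ℂ] H :=
  t.inclL.extend (Completion.toComplL : FormSpace t →L[ℂ] Completion (FormSpace t))

theorem completionL_coe (x : FormSpace t) :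
    t.completionL (x : Completion (FormSpace t)) = t.incl x :=
  t.inclL.extend_eq (Completion.denseRange_coe (α := FormSpace t))
    (Completion.isUniformInducing_coe (FormSpace t)) x

theorem norm_completionL_le (a : Completion (FormSpace t)) : ‖t.completionL a‖ ≤ ‖a‖ := by
  induction a using Completion.induction_on with
  | hp => exact isClosed_le t.completionL.continuous.norm continuous_norm
  | ih x =>
    rw [completionL_coe, Completion.norm_coe]
    exact le_of_sq_le_sq ((t.norm_sq_le_q (t.incl_mem x)).trans (t.norm_sq_formSpace x).ge)
      (norm_nonneg _)

/-- The orthogonal complement of the kernel of `completionL`. -/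
def regularSpace : Submodule ℂ (Completion (FormSpace t)) :=
  (LinearMap.ker (t.completionL : Completion (FormSpace t) →ₗ[ℂ] H))ᗮ

instance : CompleteSpace t.regularSpace :=
  inferInstanceAs (CompleteSpace (LinearMap.ker
    (t.completionL : Completion (FormSpace t) →ₗ[ℂ] H))ᗮ)

/-- The embedding of `regularSpace` into `H`. -/
def regularL : t.regularSpace →L[ℂ] H := t.completionL.comp t.regularSpace.subtypeL

/-- The orthogonal projection of a vector of the form space to `regularSpace`. -/
def regularProj (x : FormSpace t) : t.regularSpace :=
  t.regularSpace.orthogonalProjectionOnto (x : Completion (FormSpace t))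

theorem regularL_injective : Function.Injective t.regularL := by
  refine (injective_iff_map_eq_zero t.regularL).2 fun a ha => ?_
  have h := a.2 (a : Completion (FormSpace t)) ha
  exact Subtype.ext (inner_self_eq_zero.1 h)

theorem regularL_regularProj (x : FormSpace t) : t.regularL (t.regularProj x) = t.incl x := by
  have hcl : IsClosed ((LinearMap.ker
      (t.completionL : Completion (FormSpace t) →ₗ[ℂ] H) :
        Submodule ℂ (Completion (FormSpace t))) : Set (Completion (FormSpace t))) :=
    t.completionL.isClosed_ker
  have h : (x : Completion (FormSpace t)) - t.regularProj x ∈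
      (LinearMap.ker (t.completionL : Completion (FormSpace t) →ₗ[ℂ] H))ᗮᗮ :=
    t.regularSpace.sub_starProjection_mem_orthogonal _
  rw [Submodule.orthogonal_orthogonal_eq_closure,
    hcl.submodule_topologicalClosure_eq] at h
  have h' : t.completionL ((x : Completion (FormSpace t)) - t.regularProj x) = 0 := h
  rw [map_sub, completionL_coe, sub_eq_zero] at h'
  exact h'.symm

theorem denseRange_regularL : DenseRange t.regularL :=
  t.dense'.mono fun x hx => ⟨t.regularProj ⟨x, hx⟩, t.regularL_regularProj _⟩

/-- The closure of the regular part of a form. -/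
def regularClosure : PBF H :=
  ofContraction t.regularL t.regularL_injective (fun a => t.norm_completionL_le a)
    t.denseRange_regularL

theorem dom_le_regularClosure_dom : t.dom ≤ t.regularClosure.dom := fun x hx =>
  ⟨t.regularProj ⟨x, hx⟩, t.regularL_regularProj _⟩

theorem q_regularClosure (x : FormSpace t) :
    t.regularClosure.q (t.incl x) = ‖t.regularProj x‖ ^ 2 := by
  rw [← regularL_regularProj]
  exact q_ofContraction _ _ _ _ _

/-- The regular part of a form. -/
def regularPart : PBF H :=
  t.regularClosure.restrict t.dom t.dense' t.dom_le_regularClosure_dom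

theorem q_regularPart (x : FormSpace t) :
    t.regularPart.q (t.incl x) = ‖t.regularProj x‖ ^ 2 := by
  rw [← q_regularClosure, q, q, regularPart, restrict_toFun _ _ _ _ (t.incl_mem x) (t.incl_mem x)]

theorem regularPart_closable : t.regularPart.Closable :=
  ⟨t.regularClosure, isClosedForm_ofContraction _ _ _ _, t.dom_le_regularClosure_dom,
    fun _ _ hx hy => (restrict_toFun _ _ _ _ hx hy).symm⟩

/-- Closable forms dominated by `t` are dominated by the projection norm. -/
theorem q_le_of_closable {r : PBF H} (hr : r.Closable) (hd : r.dom = t.dom)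
    (hle : ∀ x ∈ t.dom, (r.toFun x x).re ≤ (t.toFun x x).re) (x : FormSpace t) :
    r.q (t.incl x) ≤ ‖t.regularProj x‖ ^ 2 := by
  obtain ⟨s, hs, hsd, hsr⟩ := hr
  have hts : t.dom ≤ s.dom := hd ▸ hsd
  have hqs : ∀ y ∈ t.dom, s.q y = r.q y := fun y hy => by
    rw [q, q, hsr y y (hd ▸ hy) (hd ▸ hy)]
  have hqt : ∀ y : FormSpace t, s.q (t.incl y) ≤ ‖y‖ ^ 2 := fun y => by
    rw [hqs _ (t.incl_mem y), norm_sq_formSpace, q, q]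
    linarith [hle _ (t.incl_mem y)]
  let P : Completion (FormSpace t) := t.regularProj x
  obtain ⟨z, hz, hzP⟩ := mem_closure_iff_seq_limit.1
    ((Completion.denseRange_coe (α := FormSpace t)) P)
  choose y hy using hz
  obtain rfl : (fun n => (y n : Completion (FormSpace t))) = z := funext hy
  obtain ⟨w, hw, hlim⟩ := hs (fun n => t.incl (y n)) (fun n => hts (t.incl_mem _)) (by
    intro ε hε
    obtain ⟨N, hN⟩ := Metric.cauchySeq_iff.1 hzP.cauchySeq (√ε) (Real.sqrt_pos.2 hε)
    refine ⟨N, fun m hm n hn => ?_⟩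
    have h := hN m hm n hn
    rw [dist_eq_norm, ← Completion.coe_sub, Completion.norm_coe] at h
    simp only [← map_sub]
    refine (hqt _).trans_lt ?_
    calc ‖y m - y n‖ ^ 2 < √ε ^ 2 := pow_lt_pow_left₀ h (norm_nonneg _) two_ne_zero
      _ = ε := Real.sq_sqrt hε.le)
  have hys : ∀ n, t.incl (y n) ∈ s.dom := fun n => hts (t.incl_mem _)
  have h2 : Tendsto (fun n => t.incl (y n)) atTop (nhds (t.incl x)) := by
    have := (t.completionL.continuous.tendsto P).comp hzP
    rw [show t.completionL P = t.incl x from t.regularL_regularProj x] at this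
    simpa only [Function.comp_def, completionL_coe] using this
  obtain rfl := tendsto_nhds_unique (s.tendsto_of_q_tendsto hys hw hlim) h2
  rw [← hqs _ (t.incl_mem x)]
  refine le_of_tendsto_of_tendsto' (s.tendsto_q hys hw hlim) (hzP.norm.pow 2) fun n => ?_
  rw [Completion.norm_coe]
  exact hqt (y n)

/-- Simon's decomposition theorem: every form has a regular part. -/
theorem isRegularPart_regularPart : t.IsRegularPart t.regularPart := by
  refine ⟨t.regularPart_closable, rfl, fun x hx => ?_, fun r hr hd hle x hx => ?_⟩
  · have h1 := t.q_regularPart ⟨x, hx⟩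
    have h2 : ‖t.regularProj ⟨x, hx⟩‖ ^ 2 ≤ t.q x := by
      refine le_trans (pow_le_pow_left₀ (norm_nonneg _) ?_ 2) (t.norm_sq_formSpace ⟨x, hx⟩).le
      exact (t.regularSpace.norm_orthogonalProjectionOnto_apply_le _).trans_eq
        (Completion.norm_coe _)
    exact le_of_add_le_add_right (h1.le.trans h2)
  · have h1 := t.q_le_of_closable hr hd hle ⟨x, hx⟩
    exact le_of_add_le_add_right (h1.trans (t.q_regularPart ⟨x, hx⟩).ge)

end Simon

end PBF

namespace PBF

/-! ### Regular parts of sums -/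

theorem IsRegularPart.unique {t a b : PBF H} (ha : t.IsRegularPart a) (hb : t.IsRegularPart b) :
    a = b :=
  ext_re (ha.2.1.trans hb.2.1.symm) fun x hx => by
    have hxt : x ∈ t.dom := ha.2.1 ▸ hx
    exact le_antisymm (hb.2.2.2 a ha.1 ha.2.1 ha.2.2.1 x hxt)
      (ha.2.2.2 b hb.1 hb.2.1 hb.2.2.1 x hxt)

theorem IsRegularPart.eq_of_closable {t a : PBF H} (ha : t.IsRegularPart a) (ht : t.Closable) :
    a = t :=
  ha.unique ⟨ht, rfl, fun _ _ => le_rfl, fun _ _ _ h => h⟩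

theorem Bounded.tendsto_q_sub {t : PBF H} (hb : t.Bounded) (hd : t.dom = ⊤) {f : ℕ → H} {x : H}
    (hx : Tendsto f atTop (nhds x)) : Tendsto (fun n => t.q (f n - x)) atTop (nhds 0) := by
  obtain ⟨c, hc⟩ := hb
  have hmem : ∀ x, x ∈ t.dom := fun x => hd ▸ Submodule.mem_top
  have h0 : Tendsto (fun n => (c + 1) * ‖f n - x‖ ^ 2) atTop (nhds 0) := by
    simpa using ((tendsto_iff_norm_sub_tendsto_zero.1 hx).pow 2).const_mul (c + 1)
  refine squeeze_zero (fun n => (sq_nonneg _).trans (t.norm_sq_le_q (hmem _))) (fun n => ?_) h0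
  rw [q]
  linarith [hc _ (hmem (f n - x))]

theorem Bounded.isClosedForm [CompleteSpace H] {t : PBF H} (hb : t.Bounded) (hd : t.dom = ⊤) :
    t.IsClosedForm := by
  intro f hf hcau
  have hmem : ∀ x, x ∈ t.dom := fun x => hd ▸ Submodule.mem_top
  have hcs : CauchySeq f := by
    refine Metric.cauchySeq_iff.2 fun ε hε => ?_
    obtain ⟨N, hN⟩ := hcau (ε ^ 2) (by positivity)
    refine ⟨N, fun m hm n hn => ?_⟩
    rw [dist_eq_norm]
    exact lt_of_pow_lt_pow_left₀ 2 hε.le ((t.norm_sq_le_q (hmem _)).trans_lt (hN m hm n hn))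
  obtain ⟨x, hx⟩ := cauchySeq_tendsto_of_complete hcs
  exact ⟨x, hmem x, hb.tendsto_q_sub hd hx⟩

/-- Bounded everywhere defined forms which agree on a dense subspace are equal. -/
theorem Bounded.eq_of_dense {t s : PBF H} (ht : t.Bounded) (htd : t.dom = ⊤) (hs : s.Bounded)
    (hsd : s.dom = ⊤) {D : Submodule ℂ H} (hD : Dense (D : Set H))
    (h : ∀ x ∈ D, (t.toFun x x).re = (s.toFun x x).re) : t = s := by
  refine ext_re (htd.trans hsd.symm) fun x _ => ?_
  obtain ⟨f, hf, hx⟩ := mem_closure_iff_seq_limit.1 (hD x)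
  have hmt : ∀ x, x ∈ t.dom := fun x => htd ▸ Submodule.mem_top
  have hms : ∀ x, x ∈ s.dom := fun x => hsd ▸ Submodule.mem_top
  have h1 := t.tendsto_q (fun n => hmt (f n)) (hmt x) (ht.tendsto_q_sub htd hx)
  have h2 := s.tendsto_q (fun n => hms (f n)) (hms x) (hs.tendsto_q_sub hsd hx)
  have h3 : (fun n => t.q (f n)) = fun n => s.q (f n) := funext fun n => by
    rw [q, q, h _ (hf n)]
  rw [h3] at h1
  exact add_right_cancel (tendsto_nhds_unique h1 h2)

theorem Bounded.closable [CompleteSpace H] {t : PBF H} (hb : t.Bounded) (hd : t.dom = ⊤) :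
    t.Closable :=
  ⟨t, hb.isClosedForm hd, le_rfl, fun _ _ _ _ => rfl⟩

theorem IsSum.isClosedForm {t s u : PBF H} (h : IsSum t s u) (ht : t.IsClosedForm)
    (hs : s.IsClosedForm) : u.IsClosedForm := by
  intro f hf hc
  have hft : ∀ n, f n ∈ t.dom := fun n => (h.mem (hf n)).1
  have hfs : ∀ n, f n ∈ s.dom := fun n => (h.mem (hf n)).2
  obtain ⟨x, hx, hlx⟩ := ht f hft fun ε hε => by
    obtain ⟨N, hN⟩ := hc ε hε
    refine ⟨N, fun m hm n hn => lt_of_le_of_lt ?_ (hN m hm n hn)⟩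
    have := s.re_nonneg _ (s.dom.sub_mem (hfs m) (hfs n))
    rw [q, q, h.re (u.dom.sub_mem (hf m) (hf n))]
    linarith
  obtain ⟨y, hy, hly⟩ := hs f hfs fun ε hε => by
    obtain ⟨N, hN⟩ := hc ε hε
    refine ⟨N, fun m hm n hn => lt_of_le_of_lt ?_ (hN m hm n hn)⟩
    have := t.re_nonneg _ (t.dom.sub_mem (hft m) (hft n))
    rw [q, q, h.re (u.dom.sub_mem (hf m) (hf n))]
    linarith
  obtain rfl := tendsto_nhds_unique (t.tendsto_of_q_tendsto hft hx hlx)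
    (s.tendsto_of_q_tendsto hfs hy hly)
  have hxu : x ∈ u.dom := by rw [h.1]; exact ⟨hx, hy⟩
  refine ⟨x, hxu, ?_⟩
  have hsum : Tendsto (fun n => t.q (f n - x) + s.q (f n - x)) atTop (nhds 0) := by
    simpa using hlx.add hly
  have hmem := fun n => u.dom.sub_mem (hf n) hxu
  refine squeeze_zero (fun n => (sq_nonneg _).trans (u.norm_sq_le_q (hmem n))) (fun n => ?_) hsum
  rw [q, q, q, h.re (hmem n)]
  linarith [sq_nonneg ‖f n - x‖]

theorem IsSum.closable {t s u : PBF H} (h : IsSum t s u) (ht : t.Closable) (hs : s.Closable) :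
    u.Closable := by
  obtain ⟨a, ha, had, hat⟩ := ht
  obtain ⟨b, hb, hbd, hbs⟩ := hs
  have hab := isSum_add a b (h.dense.mono (inf_le_inf had hbd))
  have hd : u.dom ≤ (a.add b (h.dense.mono (inf_le_inf had hbd))).dom := by
    rw [hab.1, h.1]; exact inf_le_inf had hbd
  refine ⟨_, hab.isClosedForm ha hb, hd, fun x y hx hy => ?_⟩
  rw [hab.2 x y (hd hx) (hd hy), h.2 x y hx hy, hat x y (h.mem hx).1 (h.mem hy).1,
    hbs x y (h.mem hx).2 (h.mem hy).2]

/-- The regular part is superadditive. -/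
theorem IsSum.regularPart_add_le {t s u a b c : PBF H} (h : IsSum t s u) (ha : t.IsRegularPart a)
    (hb : s.IsRegularPart b) (hc : u.IsRegularPart c) {x : H} (hx : x ∈ u.dom) :
    (a.toFun x x).re + (b.toFun x x).re ≤ (c.toFun x x).re := by
  have hd : a.dom ⊓ b.dom = t.dom ⊓ s.dom := by rw [ha.2.1, hb.2.1]
  have hab := isSum_add a b (by rw [hd]; exact h.dense)
  have hdu := hab.1.trans (hd.trans h.1.symm)
  rw [← hab.re (hdu.ge hx)]
  refine hc.2.2.2 _ (hab.closable ha.1 hb.1) hdu (fun y hy => ?_) x hx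
  rw [hab.re (hdu.ge hy), h.re hy]
  exact add_le_add (ha.2.2.1 y (h.mem hy).1) (hb.2.2.1 y (h.mem hy).2)

/-- To check that regular parts add up, it suffices to check the upper bound on the sum. -/
theorem IsSum.isSum_regularPart {t s u a b c : PBF H} (h : IsSum t s u) (ha : t.IsRegularPart a)
    (hb : s.IsRegularPart b) (hc : u.IsRegularPart c)
    (hle : ∀ x ∈ u.dom, (c.toFun x x).re ≤ (a.toFun x x).re + (b.toFun x x).re) :
    IsSum a b c :=
  isSum_of_re (by rw [hc.2.1, h.1, ha.2.1, hb.2.1]) fun x hx =>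
    have hx' : x ∈ u.dom := hc.2.1 ▸ hx
    le_antisymm (hle x hx') (h.regularPart_add_le ha hb hc hx')

/-! ### The partial operation `⊕` -/

theorem oplusDef_right_of_assoc {t s r u : PBF H} (ht : t.InVf) (hs : s.InVf)
    (hts : OplusDef t s) (h : IsSum t s u) (hur : OplusDef u r) : OplusDef s r := by
  rcases hur with hb | hb | hb
  · exact .inl (h.symm.bounded_left hb (by
      rw [(h.dom_eq_top ht hs hts hb).1]; exact le_top))
  · exact .inr (.inl hb)
  · rcases hts with hb' | hb' | hb'
    · exact .inr (.inr (by rw [← hb, h.1, ht hb', top_inf_eq]))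
    · exact .inl hb'
    · exact .inr (.inr (by rw [← hb, h.1, hb', inf_idem]))

theorem oplusDef_left_of_assoc {t s r u w : PBF H} (ht : t.InVf) (hs : s.InVf) (hr : r.InVf)
    (hts : OplusDef t s) (h : IsSum t s u) (hur : OplusDef u r) (hw : IsSum s r w) :
    OplusDef t w := by
  rcases hur with hb | hb | hb
  · exact .inl (h.bounded_left hb (by rw [(h.dom_eq_top ht hs hts hb).2]; exact le_top))
  · rcases hts with hb' | hb' | hb'
    · exact .inl hb'
    · exact .inr (.inl (hw.bounded hb' hb))
    · exact .inr (.inr (by rw [hw.1, hr hb, inf_top_eq, hb']))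
  · rcases hts with hb' | hb' | hb'
    · exact .inl hb'
    · exact .inr (.inr (by rw [hw.1, ← hb, h.1, hs hb', inf_top_eq, top_inf_eq]))
    · exact .inr (.inr (by rw [hw.1, ← hb, h.1, hb', inf_idem, inf_idem]))

theorem IsSum.assoc {t s r u v w : PBF H} (h : IsSum t s u) (h' : IsSum u r v)
    (hw : IsSum s r w) : IsSum t w v := by
  have hd : v.dom = t.dom ⊓ w.dom := by rw [h'.1, h.1, hw.1, inf_assoc]
  refine ⟨hd, fun x y hx hy => ?_⟩
  have hx' := hd ▸ hx
  have hy' := hd ▸ hy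
  rw [h'.2 x y hx hy, h.2 x y (h'.mem hx).1 (h'.mem hy).1, hw.2 x y hx'.2 hy'.2, add_assoc]

theorem IsSum.dom_eq_of_cancel {t s r u : PBF H} (ht : t.InVf) (hs : s.InVf) (hr : r.InVf)
    (hts : OplusDef t s) (htr : OplusDef t r) (h : IsSum t s u) (h' : IsSum t r u) :
    s.dom = r.dom := by
  have heq : ∀ x ∈ u.dom, (s.toFun x x).re = (r.toFun x x).re := fun x hx => by
    linarith [h.re hx, h'.re hx]
  have key : ∀ {s r : PBF H}, s.InVf → r.InVf → IsSum t s u → IsSum t r u → s.Bounded →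
      t.dom = r.dom → (∀ x ∈ u.dom, (s.toFun x x).re = (r.toFun x x).re) → s.dom = r.dom := by
    intro s r hs hr h h' hb hd heq
    rw [hs hb, hr]
    obtain ⟨c, hc⟩ := hb
    refine ⟨c, fun x hx => ?_⟩
    have hxu : x ∈ u.dom := by rw [h'.1, hd, inf_idem]; exact hx
    rw [← heq x hxu]
    exact hc x (h.mem hxu).2
  by_cases hbt : t.Bounded
  · have e := h.1.symm.trans h'.1
    rwa [ht hbt, top_inf_eq, top_inf_eq] at e
  rcases hts.resolve_left hbt with hb | hb <;> rcases htr.resolve_left hbt with hb' | hb'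
  · rw [hs hb, hr hb']
  · exact key hs hr h h' hb hb' heq
  · exact (key hr hs h' h hb' hb fun x hx => (heq x hx).symm).symm
  · rw [← hb, hb']

theorem IsSum.cancel {t s r u : PBF H} (ht : t.InVf) (hs : s.InVf) (hr : r.InVf)
    (hts : OplusDef t s) (htr : OplusDef t r) (h : IsSum t s u) (h' : IsSum t r u) : s = r := by
  have heq : ∀ x ∈ u.dom, (s.toFun x x).re = (r.toFun x x).re := fun x hx => by
    linarith [h.re hx, h'.re hx]
  have hd : s.dom = r.dom := h.dom_eq_of_cancel ht hs hr hts htr h'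
  have of_dom : u.dom = s.dom → s = r := fun e => ext_re hd fun x hx => heq x (e ▸ hx)
  rcases hts with hb | hb | hb
  · exact of_dom (by rw [h.1, ht hb, top_inf_eq])
  · rcases htr with hb' | hb' | hb'
    · exact of_dom (by rw [h.1, ht hb', top_inf_eq])
    · exact hb.eq_of_dense (hs hb) hb' (hr hb') u.dense' heq
    · exact of_dom (by rw [h.1, hb', hd, inf_idem])
  · exact of_dom (by rw [h.1, hb, inf_idem])

theorem eq_zeroPBF {t : PBF H} (hd : t.dom = ⊤) (h : ∀ x, (t.toFun x x).re ≤ 0) :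
    t = zeroPBF H :=
  ext_re hd fun x hx => le_antisymm (h x) (t.re_nonneg x hx)

theorem bounded_zeroPBF : (zeroPBF H).Bounded := ⟨0, fun _ _ => by simp [zeroPBF]⟩

theorem isSum_zeroPBF (t : PBF H) : IsSum t (zeroPBF H) t :=
  ⟨(inf_top_eq _).symm, fun _ _ _ _ => (add_zero _).symm⟩

end PBF

theorem Obar.symm {t s u : PBF H} (h : Obar t s u) : Obar s t u :=
  ⟨⟨h.1.1.symm, fun v a b c hv ha hb hc => (h.1.2 v b a c hv.symm hb ha hc).symm⟩, h.2.symm⟩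

theorem obar_zeroPBF [CompleteSpace H] (t : PBF H) : Obar t (zeroPBF H) t := by
  refine ⟨⟨.inr (.inl PBF.bounded_zeroPBF), fun u a b c hu ha hb hc => ?_⟩, t.isSum_zeroPBF⟩
  obtain rfl := hu.unique t.isSum_zeroPBF
  obtain rfl := ha.unique hc
  obtain rfl := hb.eq_of_closable (PBF.bounded_zeroPBF.closable rfl)
  exact a.isSum_zeroPBF

theorem obar_assoc_right [CompleteSpace H] {t s r u v w : PBF H} (ht : t.InVf) (hs : s.InVf)
    (hr : r.InVf) (h : Obar t s u) (h' : Obar u r v) (hw : PBF.IsSum s r w)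
    (hsr : PBF.OplusDef s r) : ObarDef s r := by
  refine ⟨hsr, fun w' a b c hw' ha hb hc => ?_⟩
  obtain rfl := hw'.unique hw
  have htw := PBF.oplusDef_left_of_assoc ht hs hr h.1.1 h.2 h'.1.1 hw
  have hsum := h.2.assoc h'.2 hw
  have hT := t.isRegularPart_regularPart
  have hU := u.isRegularPart_regularPart
  have hV := v.isRegularPart_regularPart
  have h1 := h.1.2 u _ _ _ h.2 hT ha hU
  have h2 := h'.1.2 v _ _ _ h'.2 hU hb hV
  have hle : ∀ x ∈ v.dom, (c.toFun x x).re ≤ (a.toFun x x).re + (b.toFun x x).re := by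
    intro x hx
    have e1 := h1.re (hU.2.1.ge (h'.2.mem hx).1)
    have e2 := h2.re (hV.2.1.ge hx)
    linarith [hsum.regularPart_add_le hT hc hV hx]
  have of_dom : w'.dom ≤ t.dom → PBF.IsSum a b c := fun hd =>
    hw.isSum_regularPart ha hb hc fun x hx => hle x (by rw [hsum.1]; exact ⟨hd hx, hx⟩)
  rcases htw with hb' | hb' | hb'
  · exact of_dom (by rw [ht hb']; exact le_top)
  · obtain ⟨es, er⟩ := hw.dom_eq_top hs hr hsr hb'
    have hwd : w'.dom = ⊤ := by rw [hw.1, es, er, inf_idem]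
    rw [ha.eq_of_closable ((hw.bounded_left hb' (by rw [er]; exact le_top)).closable es),
      hb.eq_of_closable ((hw.symm.bounded_left hb' (by rw [es]; exact le_top)).closable er),
      hc.eq_of_closable (hb'.closable hwd)]
    exact hw
  · exact of_dom hb'.ge

theorem obar_assoc_left [CompleteSpace H] {t s r u v w : PBF H} (ht : t.InVf) (hs : s.InVf)
    (hr : r.InVf) (h : Obar t s u) (h' : Obar u r v) (hw : PBF.IsSum s r w) :
    Obar t w v := by
  have hsum := h.2.assoc h'.2 hw
  refine ⟨⟨PBF.oplusDef_left_of_assoc ht hs hr h.1.1 h.2 h'.1.1 hw,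
    fun v' a c d hv' ha hc hd => ?_⟩, hsum⟩
  obtain rfl := hv'.unique hsum
  have hS := s.isRegularPart_regularPart
  have hR := r.isRegularPart_regularPart
  have hU := u.isRegularPart_regularPart
  have h1 := h.1.2 u _ _ _ h.2 ha hS hU
  have h2 := h'.1.2 v' _ _ _ h'.2 hU hR hd
  refine hsum.isSum_regularPart ha hc hd fun x hx => ?_
  have e1 := h1.re (hU.2.1.ge (h'.2.mem hx).1)
  have e2 := h2.re (hd.2.1.ge hx)
  linarith [hw.regularPart_add_le hS hR hc (hsum.mem hx).2]

/-- `(𝓥_f(𝓗); ⊕̄, o)` is a generalized effect algebra, where `t ⊕̄ s` is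
defined iff `t ⊕ s` is defined and `(t+s)_r = t_r + s_r`, and then `t ⊕̄ s = t ⊕ s`. -/
theorem stmt_10 [CompleteSpace H] (h_inf : ¬ FiniteDimensional ℂ H) :
    -- `o ∈ 𝓥_f(𝓗)`
    (zeroPBF H).InVf ∧
    -- single valued
    (∀ t s u v : PBF H, Obar t s u → Obar t s v → u = v) ∧
    -- well defined into `𝓥_f(𝓗)`
    (∀ t s : PBF H, t.InVf → s.InVf → ObarDef t s →
      ∃ u : PBF H, u.InVf ∧ Obar t s u) ∧
    -- (GEi) commutativity
    (∀ t s u : PBF H, t.InVf → s.InVf → Obar t s u → Obar s t u) ∧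
    -- (GEii) associativity
    (∀ t s r u v : PBF H, t.InVf → s.InVf → r.InVf → u.InVf → v.InVf →
      Obar t s u → Obar u r v →
      ∃ w : PBF H, w.InVf ∧ Obar s r w ∧ Obar t w v) ∧
    -- (GEiii) zero law
    (∀ t : PBF H, t.InVf → Obar t (zeroPBF H) t) ∧
    -- (GEiv) cancellation
    (∀ t s r u : PBF H, t.InVf → s.InVf → r.InVf → Obar t s u → Obar t r u → s = r) ∧
    -- (GEv) positivity
    (∀ t s : PBF H, t.InVf → s.InVf → Obar t s (zeroPBF H) →
      t = zeroPBF H ∧ s = zeroPBF H) := by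
  refine ⟨fun _ => rfl, fun t s u v h h' => h.2.unique h'.2, fun t s ht hs h => ?_,
    fun t s u _ _ h => h.symm, fun t s r u v ht hs hr _ _ h h' => ?_,
    fun t _ => obar_zeroPBF t,
    fun t s r u ht hs hr h h' => h.2.cancel ht hs hr h.1.1 h'.1.1 h'.2, fun t s _ _ h => ?_⟩
  · have hsum := PBF.isSum_add t s (PBF.oplusDef_dense ht hs h.1)
    exact ⟨_, hsum.inVf ht hs h.1, h, hsum⟩
  · have hsr := PBF.oplusDef_right_of_assoc ht hs h.1.1 h.2 h'.1.1
    have hw := PBF.isSum_add s r (PBF.oplusDef_dense hs hr hsr)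
    exact ⟨_, hw.inVf hs hr hsr, ⟨obar_assoc_right ht hs hr h h' hw hsr, hw⟩,
      obar_assoc_left ht hs hr h h' hw⟩
  · obtain ⟨e1, e2⟩ := inf_eq_top_iff.1 h.2.1.symm
    have hre : ∀ x, 0 = (t.toFun x x).re + (s.toFun x x).re :=
      fun x => h.2.re (x := x) Submodule.mem_top
    exact ⟨PBF.eq_zeroPBF e1 fun x => by
        linarith [hre x, s.re_nonneg x (e2 ▸ Submodule.mem_top)],
      PBF.eq_zeroPBF e2 fun x => by
        linarith [hre x, t.re_nonneg x (e1 ▸ Submodule.mem_top)]⟩
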